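/- arXiv:2402.12542 — 2 statements merged into one kernel-verified Lean document; each statement's English description precedes it below -/
import Mathlib

section
/- Let d_1, …, d_n be positive integers and let Φ ∈ ℂ^{d_1} ⊗ … ⊗ ℂ^{d_n} be a tensor such that for every 1 ≤ i ≤ n the complex symmetric matrix Φ₍ᵢ₎Φ₍ᵢ₎ᵀ has dᵢ distinct eigenvalues. Then there exist Uᵢ ∈ SO_{dᵢ}(ℂ) such that, setting Ω = (U_1ᵀ ⊗ … ⊗ U_nᵀ)Φ, the matrix Ω₍ᵢ₎Ω₍ᵢ₎ᵀ is diagonal for every 1 ≤ i ≤ n. -/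
open Matrix Polynomial

noncomputable section

/-- The mode-`i` flattening of a tensor `Φ ∈ ℂ^{d 1} ⊗ ⋯ ⊗ ℂ^{d n}`, viewed as a
`d i × ∏_{j ≠ i} d j` matrix. -/
def mflat {n : ℕ} {d : Fin n → ℕ} (Φ : (∀ i, Fin (d i)) → ℂ) (i : Fin n) :
    Matrix (Fin (d i)) ((j : {j : Fin n // j ≠ i}) → Fin (d j.1)) ℂ :=
  Matrix.of fun a w => Φ (fun j => if h : j = i then (Fin.cast (by rw [h]) a) else w ⟨j, h⟩)

/-- The action of the Kronecker product `g 1 ⊗ ⋯ ⊗ g n` of square matrices on a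
tensor `Φ ∈ ℂ^{d 1} ⊗ ⋯ ⊗ ℂ^{d n}`. -/
def mact {n : ℕ} {d : Fin n → ℕ} (g : ∀ i, Matrix (Fin (d i)) (Fin (d i)) ℂ)
    (Φ : (∀ i, Fin (d i)) → ℂ) : (∀ i, Fin (d i)) → ℂ :=
  fun v => ∑ w : ∀ i, Fin (d i), (∏ i, g i (v i) (w i)) * Φ w

/-- A complex matrix with simple spectrum has an invertible matrix of eigenvectors. -/
theorem exists_isUnit_mul_diagonal_of_charpoly_eq_prod {m : Type*} [Fintype m] [DecidableEq m]
    (A : Matrix m m ℂ) (mu : m → ℂ) (hmu : Function.Injective mu)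
    (hA : A.charpoly = ∏ p, (X - C (mu p))) :
    ∃ P : Matrix m m ℂ, IsUnit P ∧ A * P = P * diagonal mu := by
  have hev : ∀ p, ∃ v : m → ℂ, v ≠ 0 ∧ A *ᵥ v = mu p • v := by
    intro p
    have h0 : (scalar m (mu p) - A).det = 0 := by
      rw [← Matrix.eval_charpoly, hA, eval_prod]
      exact Finset.prod_eq_zero (Finset.mem_univ p) (by simp)
    obtain ⟨v, hv, hv0⟩ := Matrix.exists_mulVec_eq_zero_iff.mpr h0
    refine ⟨v, hv, ?_⟩
    rw [Matrix.sub_mulVec, sub_eq_zero] at hv0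
    rw [← hv0]
    ext k
    simp [Matrix.scalar_apply, Matrix.mulVec_diagonal]
  choose v hv0 hv using hev
  refine ⟨(Matrix.of v)ᵀ, ?_, ?_⟩
  · rw [← Matrix.linearIndependent_cols_iff_isUnit]
    refine Module.End.eigenvectors_linearIndependent' (toLin' A) mu hmu v fun p => ?_
    exact ⟨Module.End.mem_eigenspace_iff.mpr (by simpa using hv p), hv0 p⟩
  · ext a p
    rw [Matrix.mul_diagonal, mul_comm]
    exact congrFun (hv p) a

/-- A complex symmetric matrix with simple spectrum is diagonalized by a special orthogonal
matrix. -/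
theorem exists_specialOrthogonal_isDiag {m : Type*} [Fintype m] [DecidableEq m] [Nonempty m]
    (A : Matrix m m ℂ) (hsymm : A.IsSymm) (mu : m → ℂ) (hmu : Function.Injective mu)
    (hA : A.charpoly = ∏ p, (X - C (mu p))) :
    ∃ U : Matrix m m ℂ, Uᵀ * U = 1 ∧ U.det = 1 ∧ (Uᵀ * A * U).IsDiag := by
  obtain ⟨P, hP, hAP⟩ := exists_isUnit_mul_diagonal_of_charpoly_eq_prod A mu hmu hA
  have hcomm : (Pᵀ * P) * diagonal mu = diagonal mu * (Pᵀ * P) := by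
    have h := congrArg transpose hAP
    rw [transpose_mul, transpose_mul, hsymm.eq, diagonal_transpose] at h
    rw [Matrix.mul_assoc, ← hAP, ← Matrix.mul_assoc, h, Matrix.mul_assoc]
  obtain ⟨c, hc⟩ : ∃ c : m → ℂ, Pᵀ * P = diagonal c := by
    have hoff : (Pᵀ * P).IsDiag := by
      intro p q hpq
      have h := congrFun (congrFun hcomm p) q
      rw [Matrix.mul_diagonal, Matrix.diagonal_mul, mul_comm, ← sub_eq_zero, ← sub_mul] at h
      exact (mul_eq_zero.mp h).resolve_left (sub_ne_zero.mpr fun e => hpq (hmu e.symm))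
    exact ⟨_, hoff.diagonal_diag.symm⟩
  have hc0 : ∀ p, c p ≠ 0 := by
    have h : IsUnit (diagonal c) := hc ▸ ((Matrix.isUnit_transpose P).mpr hP).mul hP
    rw [Matrix.isUnit_iff_isUnit_det, det_diagonal, isUnit_iff_ne_zero,
      Finset.prod_ne_zero_iff] at h
    exact fun p => h p (Finset.mem_univ p)
  choose s hs using fun p => IsAlgClosed.exists_pow_nat_eq (c p) two_pos
  have hs0 : ∀ p, s p ≠ 0 := fun p h => hc0 p (by rw [← hs p, h]; simp)
  have horth : ∀ t : m → ℂ, (∀ p, t p ^ 2 * c p = 1) →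
      (P * diagonal t)ᵀ * (P * diagonal t) = 1 := by
    intro t ht
    rw [transpose_mul, diagonal_transpose, Matrix.mul_assoc, ← Matrix.mul_assoc _ P, hc,
      diagonal_mul_diagonal, diagonal_mul_diagonal, ← diagonal_one]
    congr 1
    funext p
    linear_combination ht p
  have hdiag : ∀ t : m → ℂ, ((P * diagonal t)ᵀ * A * (P * diagonal t)).IsDiag := by
    intro t
    have h : (P * diagonal t)ᵀ * A * (P * diagonal t) =
        diagonal t * (Pᵀ * P) * diagonal mu * diagonal t := by
      rw [transpose_mul, diagonal_transpose]
      simp only [Matrix.mul_assoc]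
      rw [← Matrix.mul_assoc A, hAP, Matrix.mul_assoc]
    rw [h, hc]
    simp only [diagonal_mul_diagonal]
    exact isDiag_diagonal _
  have ht : ∀ p, (s p)⁻¹ ^ 2 * c p = 1 := fun p => by
    rw [← hs p, ← mul_pow, inv_mul_cancel₀ (hs0 p), one_pow]
  set e := (P * diagonal fun p => (s p)⁻¹).det with he
  have he2 : e ^ 2 = 1 := by
    have h := congrArg det (horth _ ht)
    rwa [det_mul, det_transpose, det_one, ← sq] at h
  obtain ⟨k⟩ := ‹Nonempty m›
  have hupd : ∀ p, (Function.update (1 : m → ℂ) k e p) ^ 2 = 1 := by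
    intro p
    by_cases h : p = k
    · subst h; simpa using he2
    · simp [h]
  refine ⟨P * diagonal fun p => (s p)⁻¹ * Function.update (1 : m → ℂ) k e p,
    horth _ fun p => ?_, ?_, hdiag _⟩
  · rw [mul_pow, hupd, mul_one, ht]
  · rw [← diagonal_mul_diagonal, ← Matrix.mul_assoc, det_mul, ← he, det_diagonal,
      Finset.prod_update_of_mem (Finset.mem_univ k)]
    simp [← sq, he2]

/-- The Kronecker product of a finite family of square matrices. -/
def piKronecker {ι : Type*} [Fintype ι] {κ : ι → Type*} (g : ∀ i, Matrix (κ i) (κ i) ℂ) :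
    Matrix (∀ i, κ i) (∀ i, κ i) ℂ :=
  Matrix.of fun v w => ∏ i, g i (v i) (w i)

/-- A Kronecker product of orthogonal matrices is orthogonal. -/
theorem piKronecker_transpose_mul_self {ι : Type*} [Fintype ι] [DecidableEq ι] {κ : ι → Type*}
    [∀ i, Fintype (κ i)] [∀ i, DecidableEq (κ i)] (g : ∀ i, Matrix (κ i) (κ i) ℂ)
    (hg : ∀ i, (g i)ᵀ * g i = 1) : (piKronecker g)ᵀ * piKronecker g = 1 := by
  ext a b
  have h : ((piKronecker g)ᵀ * piKronecker g) a b = ∏ i, ((g i)ᵀ * g i) (a i) (b i) := by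
    simp only [piKronecker, Matrix.mul_apply, transpose_apply, of_apply, ← Finset.prod_mul_distrib]
    rw [Finset.prod_univ_sum, Fintype.piFinset_univ]
  rw [h]
  simp only [hg, Matrix.one_apply, Finset.prod_ite_zero, Finset.prod_const_one, funext_iff,
    Finset.mem_univ, true_implies]

/-- The flattening of a transformed tensor is obtained by multiplying on both sides. -/
theorem mflat_mact {n : ℕ} {d : Fin n → ℕ} (g : ∀ i, Matrix (Fin (d i)) (Fin (d i)) ℂ)
    (Φ : (∀ i, Fin (d i)) → ℂ) (i : Fin n) :
    mflat (mact g Φ) i =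
      g i * mflat Φ i * (piKronecker fun j : {j : Fin n // j ≠ i} => g j.1)ᵀ := by
  ext a w
  have hsymm : ∀ x : Fin (d i) × (∀ j : {j : Fin n // j ≠ i}, Fin (d j.1)),
      (Equiv.piSplitAt i fun j => Fin (d j)).symm x =
        fun j => if h : j = i then Fin.cast (by rw [h]) x.1 else x.2 ⟨j, h⟩ := by
    intro x
    funext j
    by_cases h : j = i
    · subst h; simp [Equiv.piSplitAt]
    · simp [Equiv.piSplitAt, h]
  simp only [mflat, mact, of_apply]
  rw [← (Equiv.piSplitAt i fun j => Fin (d j)).symm.sum_comp, Fintype.sum_prod_type,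
    Finset.sum_comm, Matrix.mul_apply]
  refine Finset.sum_congr rfl fun y _ => ?_
  rw [Matrix.mul_apply, Finset.sum_mul]
  refine Finset.sum_congr rfl fun b _ => ?_
  rw [hsymm, Fintype.prod_eq_mul_prod_subtype_ne _ i]
  have hprod : (∏ j : {j : Fin n // j ≠ i},
      g j.1 (if h : j.1 = i then Fin.cast (by rw [h]) a else w ⟨j.1, h⟩)
        (if h : j.1 = i then Fin.cast (by rw [h]) b else y ⟨j.1, h⟩)) =
      ∏ j : {j : Fin n // j ≠ i}, g j.1 (w j) (y j) :=
    Finset.prod_congr rfl fun j _ => by rw [dif_neg j.2, dif_neg j.2]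
  rw [hprod]
  simp only [piKronecker, transpose_apply, of_apply, dif_pos, Fin.cast_eq_self]
  ring

/-- Gram matrices of flattenings are equivariant under orthogonal transformations. -/
theorem mflat_mact_mul_transpose {n : ℕ} {d : Fin n → ℕ}
    (g : ∀ i, Matrix (Fin (d i)) (Fin (d i)) ℂ) (hg : ∀ i, (g i)ᵀ * g i = 1)
    (Φ : (∀ i, Fin (d i)) → ℂ) (i : Fin n) :
    mflat (mact g Φ) i * (mflat (mact g Φ) i)ᵀ =
      g i * (mflat Φ i * (mflat Φ i)ᵀ) * (g i)ᵀ := by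
  rw [mflat_mact, transpose_mul, transpose_transpose, Matrix.mul_assoc (g i * mflat Φ i),
    ← Matrix.mul_assoc (piKronecker _)ᵀ, piKronecker_transpose_mul_self _ fun j => hg j.1,
    Matrix.one_mul, transpose_mul]
  simp only [Matrix.mul_assoc]

/-- If each symmetric Gram matrix `Φ₍ᵢ₎ Φ₍ᵢ₎ᵀ` of the flattenings of a tensor `Φ`
has `d i` distinct eigenvalues, then there are `U i ∈ SO_{d i}(ℂ)` such that the
tensor `Ω = (U 1ᵀ ⊗ ⋯ ⊗ U nᵀ) Φ` has all Gram matrices `Ω₍ᵢ₎ Ω₍ᵢ₎ᵀ` diagonal. -/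
theorem orthogonal_hosvd_generic_diagonal {n : ℕ} {d : Fin n → ℕ} (hd : ∀ i, 0 < d i)
    (Φ : (∀ i, Fin (d i)) → ℂ)
    (hgen : ∀ i : Fin n, ∃ mu : Fin (d i) → ℂ, Function.Injective mu ∧
      (mflat Φ i * (mflat Φ i)ᵀ).charpoly = ∏ p, (X - C (mu p))) :
    ∃ U : ∀ i, Matrix (Fin (d i)) (Fin (d i)) ℂ,
      (∀ i, (U i)ᵀ * U i = 1 ∧ (U i).det = 1) ∧
      (∀ i, (mflat (mact (fun i => (U i)ᵀ) Φ) i *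
              (mflat (mact (fun i => (U i)ᵀ) Φ) i)ᵀ).IsDiag) := by
  have hU : ∀ i, ∃ U : Matrix (Fin (d i)) (Fin (d i)) ℂ, Uᵀ * U = 1 ∧ U.det = 1 ∧
      (Uᵀ * (mflat Φ i * (mflat Φ i)ᵀ) * U).IsDiag := by
    intro i
    obtain ⟨mu, hmu, hchar⟩ := hgen i
    have : Nonempty (Fin (d i)) := ⟨⟨0, hd i⟩⟩
    exact exists_specialOrthogonal_isDiag _
      (by rw [IsSymm, transpose_mul, transpose_transpose]) mu hmu hchar
  choose U horth hdet hdiag using hU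
  refine ⟨U, fun i => ⟨horth i, hdet i⟩, fun i => ?_⟩
  rw [mflat_mact_mul_transpose _ fun j => by
    rw [transpose_transpose]; exact mul_eq_one_comm.mp (horth j)]
  simpa only [transpose_transpose] using hdiag i

end
end

section
/- Let n ≥ 5 be odd. Suppose Ω, Ω′ ∈ (ℂ²)^{⊗n} both satisfy: for every 1 ≤ i ≤ n, (a) the matrix Ω₍ᵢ₎ · J^{⊗(n−1)} · Ω₍ᵢ₎ᵀ equals z_i·I_2 for some nonzero z_i ∈ ℂ with z_i ≥ −z_i in the lexicographic order on ℂ, and (b) the matrix Ω₍ᵢ₎ · Ω₍ᵢ₎ᵀ is diagonal with its two diagonal entries distinct and strictly decreasing in the lexicographic order on ℂ (and the analogous conditions hold for Ω′). If Ω′ = (A_1 ⊗ … ⊗ A_n)Ω for some A_1, …, A_n ∈ SL_2(ℂ), then Ω′ = Ω or Ω′ = −Ω. -/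
open Matrix

noncomputable section

/-- The standard symplectic `2 × 2` matrix `J`. -/
def J : Matrix (Fin 2) (Fin 2) ℂ := !![0, 1; -1, 0]

/-- The Kronecker power `J^{⊗ι}` of `J`, indexed by an arbitrary finite index type. -/
def kronPowJ (ι : Type) [Fintype ι] : Matrix (ι → Fin 2) (ι → Fin 2) ℂ :=
  Matrix.of fun v w => ∏ j, J (v j) (w j)

/-- The mode-`i` flattening of an `n`-qubit tensor, as a `2 × 2^{n-1}` matrix. -/
def qflat {n : ℕ} (Φ : (Fin n → Fin 2) → ℂ) (i : Fin n) :
    Matrix (Fin 2) ({j : Fin n // j ≠ i} → Fin 2) ℂ :=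
  Matrix.of fun a w => Φ (fun j => if h : j = i then a else w ⟨j, h⟩)

/-- The action of the Kronecker product `A 1 ⊗ ⋯ ⊗ A n` of `2 × 2` matrices on an
`n`-qubit tensor. -/
def act2 {n : ℕ} (A : Fin n → Matrix (Fin 2) (Fin 2) ℂ)
    (Φ : (Fin n → Fin 2) → ℂ) : (Fin n → Fin 2) → ℂ :=
  fun v => ∑ w : Fin n → Fin 2, (∏ i, A i (v i) (w i)) * Φ w

/-- The (weak) lexicographic order on `ℂ`: real parts first, then imaginary parts. -/
def clexLe (z w : ℂ) : Prop := z.re < w.re ∨ (z.re = w.re ∧ z.im ≤ w.im)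

/-- The strict lexicographic order on `ℂ`. -/
def clexLt (z w : ℂ) : Prop := z.re < w.re ∨ (z.re = w.re ∧ z.im < w.im)

end

noncomputable section

/-- The Kronecker product of a family of `2 × 2` matrices. -/
def kronFamily {ι : Type} [Fintype ι] (A : ι → Matrix (Fin 2) (Fin 2) ℂ) :
    Matrix (ι → Fin 2) (ι → Fin 2) ℂ :=
  Matrix.of fun v w => ∏ j, A j (v j) (w j)

section KroneckerFamily

variable {ι : Type} [Fintype ι]

theorem kronFamily_mul [DecidableEq ι] (A B : ι → Matrix (Fin 2) (Fin 2) ℂ) :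
    kronFamily A * kronFamily B = kronFamily fun j => A j * B j := by
  ext v w
  simp only [kronFamily, Matrix.mul_apply, Matrix.of_apply, Fintype.prod_sum,
    Finset.prod_mul_distrib]

theorem kronFamily_transpose (A : ι → Matrix (Fin 2) (Fin 2) ℂ) :
    (kronFamily A)ᵀ = kronFamily fun j => (A j)ᵀ := rfl

theorem kronFamily_const_J : kronFamily (fun _ : ι => J) = kronPowJ ι := rfl

theorem kronFamily_one [DecidableEq ι] :
    kronFamily (fun _ : ι => (1 : Matrix (Fin 2) (Fin 2) ℂ)) = 1 := by
  ext v w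
  simp only [kronFamily, Matrix.of_apply, Matrix.one_apply, Finset.prod_ite_zero,
    Finset.prod_const_one, Finset.mem_univ, true_imp_iff, funext_iff]

theorem transpose_mul_J_mul_self (A : Matrix (Fin 2) (Fin 2) ℂ) (hA : A.det = 1) :
    Aᵀ * _root_.J * A = _root_.J := by
  rw [Matrix.det_fin_two] at hA
  ext i j
  fin_cases i <;> fin_cases j <;>
    simp [_root_.J, Matrix.mul_apply, Fin.sum_univ_two] <;> grind

theorem kronFamily_transpose_mul_kronPowJ_mul_self [DecidableEq ι]
    (A : ι → Matrix (Fin 2) (Fin 2) ℂ) (hA : ∀ j, (A j).det = 1) :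
    (kronFamily A)ᵀ * kronPowJ ι * kronFamily A = kronPowJ ι := by
  simp only [kronFamily_transpose, ← kronFamily_const_J, kronFamily_mul,
    fun j => transpose_mul_J_mul_self (A j) (hA j)]

theorem kronFamily_transpose_mul_self [DecidableEq ι]
    (A : ι → Matrix (Fin 2) (Fin 2) ℂ) (hA : ∀ j, (A j)ᵀ * A j = 1) :
    (kronFamily A)ᵀ * kronFamily A = 1 := by
  simp only [kronFamily_transpose, kronFamily_mul, hA, kronFamily_one]

end KroneckerFamily

theorem qflat_act2 {n : ℕ} (A : Fin n → Matrix (Fin 2) (Fin 2) ℂ)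
    (Φ : (Fin n → Fin 2) → ℂ) (i : Fin n) :
    qflat (act2 A Φ) i =
      A i * qflat Φ i * (kronFamily fun j : {j : Fin n // j ≠ i} => A j)ᵀ := by
  ext a w
  simp only [qflat, act2, Matrix.of_apply, Matrix.mul_apply, Matrix.transpose_apply, kronFamily,
    Finset.sum_mul]
  rw [← (Equiv.funSplitAt i (Fin 2)).symm.sum_comp, Fintype.sum_prod_type, Finset.sum_comm]
  refine Finset.sum_congr rfl fun u _ => Finset.sum_congr rfl fun b _ => ?_
  rw [← Fintype.prod_subtype_mul_prod_subtype (fun j => j = i)]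
  have hsymm : (Equiv.funSplitAt i (Fin 2)).symm (b, u) =
      fun j => if h : j = i then b else u ⟨j, h⟩ := by
    funext j
    simp
  have hdiag : ∀ j : {j : Fin n // j = i},
      A j (if h : (j : Fin n) = i then a else w ⟨j, h⟩)
        (if h : (j : Fin n) = i then b else u ⟨j, h⟩) = A i a b := by
    intro j
    simp [j.2]
  have hrest : ∀ j : {j : Fin n // ¬ j = i},
      A j (if h : (j : Fin n) = i then a else w ⟨j, h⟩)
        (if h : (j : Fin n) = i then b else u ⟨j, h⟩) = A j (w j) (u j) := by
    intro j
    simp [j.2]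
  rw [hsymm]
  simp only [hdiag, hrest, Fintype.prod_unique]
  ring

/-- A flattening of the transformed tensor contracted with any bilinear form `M` that is
invariant under the other factors is congruent, via `A i`, to the original contraction. -/
theorem qflat_act2_mul_mul_transpose {n : ℕ} (A : Fin n → Matrix (Fin 2) (Fin 2) ℂ)
    (Φ : (Fin n → Fin 2) → ℂ) (i : Fin n)
    (M : Matrix ({j : Fin n // j ≠ i} → Fin 2) ({j : Fin n // j ≠ i} → Fin 2) ℂ)
    (hM : (kronFamily fun j : {j : Fin n // j ≠ i} => A j)ᵀ * M *
      (kronFamily fun j : {j : Fin n // j ≠ i} => A j) = M) :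
    qflat (act2 A Φ) i * M * (qflat (act2 A Φ) i)ᵀ =
      A i * (qflat Φ i * M * (qflat Φ i)ᵀ) * (A i)ᵀ := by
  conv_rhs => rw [← hM]
  simp only [qflat_act2, Matrix.transpose_mul, Matrix.transpose_transpose, Matrix.mul_assoc]

theorem eq_of_sq_eq_sq_of_clexLe {z w : ℂ} (hz : clexLe (-z) z) (hw : clexLe (-w) w)
    (h : w ^ 2 = z ^ 2) : w = z := by
  rcases sq_eq_sq_iff_eq_or_eq_neg.mp h with h | rfl
  · exact h
  · unfold clexLe at hz hw
    simp only [Complex.neg_re, Complex.neg_im, neg_neg] at hz hw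
    apply Complex.ext <;> simp only [Complex.neg_re, Complex.neg_im] <;> grind

theorem mul_transpose_eq_one_of_normalized {A : Matrix (Fin 2) (Fin 2) ℂ} (hA : A.det = 1)
    {z w : ℂ} (hz0 : z ≠ 0) (hz : clexLe (-z) z) (hw : clexLe (-w) w)
    (h : w • (1 : Matrix (Fin 2) (Fin 2) ℂ) = A * (z • 1) * Aᵀ) : A * Aᵀ = 1 := by
  have hdet := congrArg Matrix.det h
  have hwz : w = z := eq_of_sq_eq_sq_of_clexLe hz hw <| by
    simpa [Matrix.det_smul, hA] using hdet
  rw [hwz, Matrix.mul_smul, Matrix.mul_one, Matrix.smul_mul] at h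
  exact (smul_right_injective _ hz0 h).symm

theorem eq_one_or_eq_neg_one_of_mul_diagonal_mul_transpose {A : Matrix (Fin 2) (Fin 2) ℂ}
    (hA : A.det = 1) (hAA : A * Aᵀ = 1) {a b a' b' : ℂ} (hab : clexLt b a)
    (hab' : clexLt b' a')
    (h : Matrix.diagonal ![a', b'] = A * Matrix.diagonal ![a, b] * Aᵀ) :
    A = 1 ∨ A = -1 := by
  have hinv : Aᵀ = A.adjugate := by
    calc Aᵀ = A.adjugate * A * Aᵀ := by simp [Matrix.adjugate_mul, hA]
      _ = A.adjugate := by rw [Matrix.mul_assoc, hAA, Matrix.mul_one]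
  have hne : a - b ≠ 0 := by
    rintro hz
    obtain rfl := sub_eq_zero.mp hz
    simp [clexLt] at hab
  have h10 : A 0 1 = -A 1 0 := by
    simpa [Matrix.adjugate_fin_two] using congrFun (congrFun hinv 1) 0
  have h11 : A 0 0 = A 1 1 := by
    simpa [Matrix.adjugate_fin_two] using congrFun (congrFun hinv 0) 0
  rw [Matrix.det_fin_two, h10, h11] at hA
  have e00 := congrFun (congrFun h 0) 0
  have e01 := congrFun (congrFun h 0) 1
  have e11 := congrFun (congrFun h 1) 1
  simp [Matrix.mul_apply, Fin.sum_univ_two, h10, h11] at e00 e01 e11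
  have hprod : A 1 1 * A 1 0 = 0 := by
    apply (mul_eq_zero.mp _).resolve_left hne
    linear_combination -e01
  rcases mul_eq_zero.mp hprod with h0 | h0
  · exfalso
    rw [h0] at hA e00 e11
    have ha' : a' = b := by linear_combination e00 + b * hA
    have hb' : b' = a := by linear_combination e11 + a * hA
    subst ha' hb'
    unfold clexLt at hab hab'
    grind
  · rw [h0] at hA h10
    rcases mul_self_eq_one_iff.mp (by linear_combination hA : A 1 1 * A 1 1 = 1) with h1 | h1
    · left
      ext i j
      fin_cases i <;> fin_cases j <;> simp [h10, h11, h0, h1]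
    · right
      ext i j
      fin_cases i <;> fin_cases j <;> simp [h10, h11, h0, h1]

theorem act2_smul_one {n : ℕ} (s : Fin n → ℂ) (Φ : (Fin n → Fin 2) → ℂ) :
    act2 (fun i => s i • (1 : Matrix (Fin 2) (Fin 2) ℂ)) Φ = (∏ i, s i) • Φ := by
  funext v
  simp only [act2, Matrix.smul_apply, Matrix.one_apply, smul_eq_mul, Finset.prod_mul_distrib,
    Finset.prod_ite_zero, Finset.prod_const_one, Pi.smul_apply]
  simp [← funext_iff]

theorem prod_eq_one_or_eq_neg_one {ι : Type} (t : Finset ι) (s : ι → ℂ)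
    (hs : ∀ i, s i = 1 ∨ s i = -1) : ∏ i ∈ t, s i = 1 ∨ ∏ i ∈ t, s i = -1 :=
  Finset.prod_induction s (fun x => x = 1 ∨ x = -1)
    (by rintro _ _ (rfl | rfl) (rfl | rfl) <;> simp) (Or.inl rfl) fun i _ => hs i

/-- **Uniqueness (up to sign) of odd SLOCC normal forms.** Let `n ≥ 5` be odd and
suppose `Ω` and `Ω'` both satisfy: each `Ω₍ᵢ₎ J^{⊗(n-1)} Ω₍ᵢ₎ᵀ = z • I₂` with
`z ≠ 0` and `z ≥ -z` lexicographically, and each `Ω₍ᵢ₎ Ω₍ᵢ₎ᵀ` is diagonal with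
strictly decreasing (in particular distinct) diagonal entries in the lexicographic
order on `ℂ`.  If `Ω' = (A 1 ⊗ ⋯ ⊗ A n) Ω` for some `A i ∈ SL_2(ℂ)`, then
`Ω' = Ω` or `Ω' = -Ω`. -/
theorem odd_slocc_normal_form_unique_up_to_sign {n : ℕ} (hn5 : 5 ≤ n) (hn : Odd n)
    (Ω Ω' : (Fin n → Fin 2) → ℂ)
    (ha : ∀ i : Fin n, ∃ z : ℂ, z ≠ 0 ∧ clexLe (-z) z ∧
      qflat Ω i * kronPowJ {j : Fin n // j ≠ i} * (qflat Ω i)ᵀ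
        = z • (1 : Matrix (Fin 2) (Fin 2) ℂ))
    (hb : ∀ i : Fin n, ∃ a b : ℂ, clexLt b a ∧
      qflat Ω i * (qflat Ω i)ᵀ = Matrix.diagonal ![a, b])
    (ha' : ∀ i : Fin n, ∃ z : ℂ, z ≠ 0 ∧ clexLe (-z) z ∧
      qflat Ω' i * kronPowJ {j : Fin n // j ≠ i} * (qflat Ω' i)ᵀ
        = z • (1 : Matrix (Fin 2) (Fin 2) ℂ))
    (hb' : ∀ i : Fin n, ∃ a b : ℂ, clexLt b a ∧
      qflat Ω' i * (qflat Ω' i)ᵀ = Matrix.diagonal ![a, b])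
    (A : Fin n → Matrix (Fin 2) (Fin 2) ℂ) (hA : ∀ i, (A i).det = 1)
    (hAct : Ω' = act2 A Ω) :
    Ω' = Ω ∨ Ω' = -Ω := by
  subst hAct
  have horth : ∀ i, A i * (A i)ᵀ = 1 := by
    intro i
    obtain ⟨z, hz0, hz, hzΩ⟩ := ha i
    obtain ⟨w, -, hw, hwΩ⟩ := ha' i
    rw [qflat_act2_mul_mul_transpose A Ω i _
      (kronFamily_transpose_mul_kronPowJ_mul_self _ fun j => hA j), hzΩ] at hwΩ
    exact mul_transpose_eq_one_of_normalized (hA i) hz0 hz hw hwΩ.symm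
  have hsign : ∀ i, ∃ s : ℂ, (s = 1 ∨ s = -1) ∧ A i = s • 1 := by
    intro i
    obtain ⟨a, b, hab, hΩ⟩ := hb i
    obtain ⟨a', b', hab', hΩ'⟩ := hb' i
    have hcongr := qflat_act2_mul_mul_transpose A Ω i 1 (by
      rw [Matrix.mul_one]
      exact kronFamily_transpose_mul_self _ fun j => mul_eq_one_comm.mp (horth j))
    rw [Matrix.mul_one, Matrix.mul_one, hΩ, hΩ'] at hcongr
    rcases eq_one_or_eq_neg_one_of_mul_diagonal_mul_transpose (hA i) (horth i) hab hab' hcongr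
      with h | h
    · exact ⟨1, Or.inl rfl, by simp [h]⟩
    · exact ⟨-1, Or.inr rfl, by simp [h]⟩
  choose s hs hAs using hsign
  rw [funext hAs, act2_smul_one]
  rcases prod_eq_one_or_eq_neg_one Finset.univ s hs with h | h <;> simp [h]

end
end
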